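/- Let P : g → g be ad-equivariant and homogeneous of degree m ≥ 1, and let h, e ∈ g satisfy [h, e] = 2e. Then for every integer k with 0 ≤ k ≤ m: (ad e)^{m−k}(dᵏP(h).e⁽ᵏ⁾) = (−2)^{m−k}·m!·P(e). -/

import Mathlib

open Filter Topology

section LineDerivatives

variable {𝕜 E F : Type*} [NontriviallyNormedField 𝕜] [NormedAddCommGroup E] [NormedSpace 𝕜 E]
  [NormedAddCommGroup F] [NormedSpace 𝕜 F] {f : E → F} {n : ℕ}

/-- The iterated derivatives of `f` along a line are its iterated Fréchet derivatives evaluated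
on the diagonal at the direction of the line. -/
theorem ContDiff.iteratedDeriv_comp_add_smul (hf : ContDiff 𝕜 n f) (x y : E) (t : 𝕜) :
    iteratedDeriv n (fun s : 𝕜 ↦ f (x + s • y)) t =
      iteratedFDeriv 𝕜 n f (x + t • y) (fun _ ↦ y) := by
  induction n generalizing t with
  | zero => simp
  | succ n ih =>
    have hfn : ContDiff 𝕜 n f := hf.of_le (by norm_cast; exact n.le_succ)
    rw [iteratedDeriv_succ, funext (ih hfn)]
    exact ContDiffAt.deriv_fderiv_add_smul (by exact_mod_cast hf.contDiffAt)

/-- The `n`-th derivative of a map that is homogeneous of degree `n` is constant. -/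
theorem ContDiff.iteratedFDeriv_eq_apply_zero_of_homogeneous (hf : ContDiff 𝕜 n f)
    (hhom : ∀ (t : 𝕜) (x : E), f (t • x) = t ^ n • f x) (x : E) :
    iteratedFDeriv 𝕜 n f x = iteratedFDeriv 𝕜 n f 0 := by
  have hinv : ∀ t : 𝕜, t ≠ 0 → iteratedFDeriv 𝕜 n f (t • x) = iteratedFDeriv 𝕜 n f x := by
    intro t ht
    have hcomp := congrFun (iteratedFDeriv_comp_const_smul t hf) x
    rw [funext (hhom t), iteratedFDeriv_const_smul_apply' hf.contDiffAt] at hcomp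
    exact (smul_right_injective _ (pow_ne_zero n ht) hcomp).symm
  have hcont : Continuous fun t : 𝕜 ↦ iteratedFDeriv 𝕜 n f (t • x) :=
    (hf.continuous_iteratedFDeriv le_rfl).comp (by fun_prop)
  have hlim : Tendsto (fun t : 𝕜 ↦ iteratedFDeriv 𝕜 n f (t • x)) (𝓝[≠] 0)
      (𝓝 (iteratedFDeriv 𝕜 n f 0)) := by
    simpa using (hcont.tendsto 0).mono_left nhdsWithin_le_nhds
  refine tendsto_nhds_unique (tendsto_const_nhds.congr' ?_) hlim
  filter_upwards [self_mem_nhdsWithin] with t ht using (hinv t ht).symm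

/-- The `n`-th derivative of a map that is homogeneous of degree `n` is, on the diagonal,
`n!` times the map itself. -/
theorem ContDiff.iteratedFDeriv_apply_diag_of_homogeneous (hf : ContDiff 𝕜 n f)
    (hhom : ∀ (t : 𝕜) (x : E), f (t • x) = t ^ n • f x) (x y : E) :
    iteratedFDeriv 𝕜 n f x (fun _ ↦ y) = (n.factorial : 𝕜) • f y := by
  have hline := hf.iteratedDeriv_comp_add_smul 0 y (0 : 𝕜)
  simp only [zero_add, zero_smul, hhom] at hline
  rw [hf.iteratedFDeriv_eq_apply_zero_of_homogeneous hhom, ← hline,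
    iteratedDeriv_smul_const (by fun_prop), iteratedDeriv_fun_pow_zero, if_pos rfl]

/-- If the derivative of `f` along the line `x + s • y` satisfies `L (f ·) = c • (f ·)'`, then
`L ^ j` raises the order of the derivatives along this line by `j`, up to the factor `c ^ j`. -/
theorem ContDiff.pow_apply_iteratedFDeriv_diag (hf : ContDiff 𝕜 ⊤ f) (L : F →L[𝕜] F) (c : 𝕜)
    (x y : E) (hL : ∀ s : 𝕜, L (f (x + s • y)) = c • fderiv 𝕜 f (x + s • y) y) (k j : ℕ) :
    (L ^ j) (iteratedFDeriv 𝕜 k f x (fun _ ↦ y)) =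
      c ^ j • iteratedFDeriv 𝕜 (k + j) f x (fun _ ↦ y) := by
  have hfn (i : ℕ) : ContDiff 𝕜 i f := hf.of_le le_top
  have hstep (i : ℕ) (s : 𝕜) : L (iteratedFDeriv 𝕜 i f (x + s • y) (fun _ ↦ y)) =
      c • iteratedFDeriv 𝕜 (i + 1) f (x + s • y) (fun _ ↦ y) := by
    have hline : ContDiff 𝕜 i fun s : 𝕜 ↦ f (x + s • y) := (hfn i).comp (by fun_prop)
    have hderiv : (fun s : 𝕜 ↦ L (f (x + s • y))) = c • deriv fun s : 𝕜 ↦ f (x + s • y) := by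
      funext s
      rw [hL, Pi.smul_apply, ((hfn 1).differentiable (by simp) _).deriv_comp_add_smul]
    rw [← (hfn i).iteratedDeriv_comp_add_smul, ← (hfn (i + 1)).iteratedDeriv_comp_add_smul,
      iteratedDeriv_succ', ← iteratedDeriv_const_smul_field, ← hderiv]
    have hleft := L.iteratedFDeriv_comp_left (x := s) hline.contDiffAt le_rfl
    exact congrArg (fun T ↦ T fun _ ↦ 1) hleft.symm
  induction j with
  | zero => simp
  | succ j ih =>
    have h0 := hstep (k + j) 0
    rw [zero_smul, add_zero] at h0
    rw [pow_succ', mul_apply_eq_comp, ih, map_smul, h0, smul_smul, pow_succ, add_assoc]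

end LineDerivatives


theorem stmt {g : Type*} [NormedAddCommGroup g] [NormedSpace ℂ g] [FiniteDimensional ℂ g]
    -- `lie` is the Lie bracket of the finite-dimensional complex Lie algebra `g`,
    -- given as bilinear data so that it is compatible with the normed space structure.
    (lie : g →ₗ[ℂ] g →ₗ[ℂ] g)
    (lie_self : ∀ x : g, lie x x = 0)
    (lie_jacobi : ∀ x y z : g, lie x (lie y z) = lie (lie x y) z + lie y (lie x z))
    (P : g → g) (hP : ContDiff ℂ ⊤ P)
    (hPeq : ∀ x y : g, fderiv ℂ P x (lie y x) = lie y (P x))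
    (m : ℕ) (hm : 1 ≤ m)
    (hhom : ∀ (t : ℂ) (x : g), P (t • x) = t ^ m • P x)
    (h e : g) (hhe : lie h e = (2 : ℂ) • e)
    (k : ℕ) (hk : k ≤ m) :
    (lie e ^ (m - k)) (iteratedFDeriv ℂ k P h (fun _ => e))
      = ((-2 : ℂ) ^ (m - k) * (m.factorial : ℂ)) • P e := by
  have lie_e_h : lie e h = (-2 : ℂ) • e := by
    have hsum := lie_self (h + e)
    simp only [map_add, LinearMap.add_apply, lie_self, hhe, zero_add, add_zero] at hsum
    rw [neg_smul]
    exact eq_neg_of_add_eq_zero_left hsum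
  have hL (s : ℂ) : LinearMap.toContinuousLinearMap (lie e) (P (h + s • e)) =
      (-2 : ℂ) • fderiv ℂ P (h + s • e) e := by
    rw [LinearMap.coe_toContinuousLinearMap', ← hPeq, map_add, map_smul, lie_self, smul_zero,
      add_zero, lie_e_h, map_smul]
  have hpow := hP.pow_apply_iteratedFDeriv_diag _ _ h e hL k (m - k)
  have hcoe (j : ℕ) (v : g) :
      (LinearMap.toContinuousLinearMap (lie e) ^ j) v = (lie e ^ j) v := by
    rw [FunLike.coe_pow_eq_iterate, Module.End.pow_apply, LinearMap.coe_toContinuousLinearMap']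
  rw [← hcoe, hpow, Nat.add_sub_cancel' hk,
    (hP.of_le le_top).iteratedFDeriv_apply_diag_of_homogeneous hhom, smul_smul]
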